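/- Let a, b, r be real numbers with a > b > 0 and r > 0, and let H(x,y,a,b,r) be the degree-twelve polynomial defined in the context. Then the two points S1 = (0, sqrt((a^2 + b^2)*(r^2 + b^2))/b) and S2 = (0, -sqrt((a^2 + b^2)*(r^2 + b^2))/b) lie on the variety V(H) and are critical points of H as a function of (x,y): at each of these two points H = 0, ∂H/∂x = 0 and ∂H/∂y = 0, where the partial derivatives are taken with respect to x and y with a, b, r held fixed. -/

import Mathlib

set_option maxHeartbeats 2000000
set_option maxRecDepth 100000

/-- The degree-twelve polynomial defining the parallel lines to the hyperbola
b^2*y^2 - a^2*x^2 = a^2*b^2 at offset r. -/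
noncomputable def HHyp (x y a b r : ℝ) : ℝ :=
  6*a^4*x^4*r^4 - 2*b^2*x^4*a^2*r^2*y^2 + 4*b^6*x^2*a^4 + 2*a^8*b^2*x^2 + 2*a^6*x^6 +
    6*y^4*a^2*b^6 - 2*a^4*b^2*x^4*y^2 + 4*a^4*x^6*b^2 - 6*a^6*x^2*b^2*y^2 - 4*a^6*x^2*b^2*r^2 -
    10*a^4*x^2*b^4*y^2 - 8*a^4*x^2*b^4*r^2 + 8*a^4*x^2*b^2*r^4 - 6*b^4*r^2*a^2*x^4 +
    4*b^4*r^4*a^2*x^2 - 10*a^4*x^4*b^2*r^2 - 6*b^4*r^2*a^2*x^2*y^2 + 6*a^4*x^2*b^2*r^2*y^2 -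
    6*b^4*x^4*a^2*y^2 + 2*b^4*x^2*y^4*a^2 - 6*b^6*x^2*r^2*a^2 + 10*b^4*y^4*a^2*r^2 -
    8*b^4*y^2*a^4*r^2 - 4*b^6*y^2*r^2*a^2 - 8*b^4*y^2*r^4*a^2 + 6*y^4*a^4*b^2*x^2 -
    2*a^2*y^2*b^8 + 6*b^4*y^4*a^4 - 4*b^4*y^6*a^2 - 6*y^2*a^4*b^6 + 6*a^4*x^4*b^4 -
    4*y^2*a^6*b^4 - 6*y^2*a^6*r^2*b^2 + 6*y^4*a^4*r^2*b^2 - 4*y^2*a^4*r^4*b^2 + 2*a^6*b^6 +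
    a^4*b^8 + 6*a^6*b^4*x^2 + 6*a^6*x^4*b^2 + b^8*r^4 + a^8*b^4 - 2*a^2*b^8*r^2 - 2*a^2*b^6*r^4 +
    2*b^6*x^2*r^4 - 4*b^6*x^2*y^2*r^2 + 6*b^2*x^4*a^2*r^4 + 4*a^6*x^2*r^2*y^2 -
    2*b^2*x^2*a^2*y^6 + 2*b^4*x^2*y^6 - 2*b^2*x^2*y^4*a^2*r^2 + 6*b^4*x^2*y^2*r^4 +
    10*b^2*x^2*y^2*a^2*r^4 + 2*b^6*x^2*y^4 - 6*b^4*x^2*y^4*r^2 + a^4*x^8 + 2*b^6*r^6 + b^4*r^8 +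
    6*a^6*x^2*r^4 - 6*a^6*x^4*r^2 - 2*a^8*x^2*r^2 - 6*a^4*b^4*r^4 - 2*a^4*b^6*r^2 -
    2*a^6*y^2*r^4 - 2*a^6*b^2*r^4 - 6*a^2*r^6*b^2*y^2 - 2*a^4*r^6*y^2 - 6*a^4*x^4*r^2*y^2 +
    6*a^2*y^4*b^2*r^4 + 2*a^8*b^2*r^2 + a^4*y^4*r^4 - 2*a^2*y^6*b^2*r^2 - 4*a^4*r^6*x^2 +
    a^8*x^4 + 6*a^4*x^2*y^2*r^4 - 4*a^4*x^6*r^2 + a^8*r^4 + 2*a^4*x^6*y^2 - 2*a^6*x^4*y^2 -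
    2*a^6*r^6 - 2*a^4*r^6*b^2 + 2*a^6*r^2*b^4 + a^4*y^4*x^4 + 2*a^2*r^8*b^2 -
    2*a^4*y^4*x^2*r^2 + 2*a^2*b^4*r^6 + a^4*r^8 + 6*y^4*b^4*r^4 + 6*y^4*b^6*r^2 -
    4*y^6*b^4*r^2 - 4*y^2*b^4*r^6 - 6*y^2*b^6*r^4 + y^4*b^8 + y^8*b^4 - 2*y^6*b^6 -
    2*b^2*x^6*a^2*y^2 - 2*b^4*x^2*r^6 - 6*b^2*x^2*r^6*a^2 + b^4*x^4*y^4 - 4*b^2*x^4*y^4*a^2 +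
    b^4*x^4*r^4 - 2*b^2*x^6*a^2*r^2 - 2*b^4*x^4*r^2*y^2 - 2*y^2*b^8*r^2 - 6*y^2*x^2*a^2*b^6

lemma HHyp_zero (y a b r : ℝ) : HHyp 0 y a b r =
    (b^2*y^2 - (a^2+b^2)*(r^2+b^2))^2 * ((y^2-(a+r)^2)*(y^2-(a-r)^2)) := by
  unfold HHyp; ring

lemma HHyp_even (x y a b r : ℝ) : HHyp (-x) y a b r = HHyp x y a b r := by
  unfold HHyp; ring

lemma deriv_x (y a b r : ℝ) : deriv (fun t : ℝ => HHyp t y a b r) 0 = 0 := by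
  have h := deriv_comp_neg (fun t : ℝ => HHyp t y a b r) 0
  simp only [HHyp_even, neg_zero] at h
  linarith

lemma deriv_y (y a b r : ℝ) (h : b^2*y^2 - (a^2+b^2)*(r^2+b^2) = 0) :
    deriv (fun t : ℝ => HHyp 0 t a b r) y = 0 := by
  simp only [HHyp_zero]
  have h1 : HasDerivAt (fun t : ℝ => b^2*t^2 - (a^2+b^2)*(r^2+b^2)) (b^2*(2*y)) y := by
    simpa using ((hasDerivAt_pow 2 y).const_mul (b^2)).sub_const ((a^2+b^2)*(r^2+b^2))
  have h2 : DifferentiableAt ℝ (fun t : ℝ => (t^2-(a+r)^2)*(t^2-(a-r)^2)) y := by fun_prop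
  have h3 := (h1.pow 2).mul h2.hasDerivAt
  refine h3.deriv.trans ?_
  simp [h]

theorem hyperbola_axis_singular_points (a b r : ℝ) (hab : b < a) (hb : 0 < b) (hr : 0 < r) :
    (HHyp 0 (Real.sqrt ((a^2 + b^2)*(r^2 + b^2))/b) a b r = 0 ∧
     deriv (fun t : ℝ => HHyp t (Real.sqrt ((a^2 + b^2)*(r^2 + b^2))/b) a b r) 0 = 0 ∧
     deriv (fun t : ℝ => HHyp 0 t a b r) (Real.sqrt ((a^2 + b^2)*(r^2 + b^2))/b) = 0) ∧
    (HHyp 0 (-(Real.sqrt ((a^2 + b^2)*(r^2 + b^2))/b)) a b r = 0 ∧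
     deriv (fun t : ℝ => HHyp t (-(Real.sqrt ((a^2 + b^2)*(r^2 + b^2))/b)) a b r) 0 = 0 ∧
     deriv (fun t : ℝ => HHyp 0 t a b r) (-(Real.sqrt ((a^2 + b^2)*(r^2 + b^2))/b)) = 0) := by
  have hy : b^2*(Real.sqrt ((a^2 + b^2)*(r^2 + b^2))/b)^2 - (a^2+b^2)*(r^2+b^2) = 0 := by
    rw [div_pow, Real.sq_sqrt (by positivity)]
    field_simp
    ring
  have hy' : b^2*(-(Real.sqrt ((a^2 + b^2)*(r^2 + b^2))/b))^2 - (a^2+b^2)*(r^2+b^2) = 0 := by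
    rw [neg_sq]; exact hy
  refine ⟨⟨?_, deriv_x _ _ _ _, deriv_y _ _ _ _ hy⟩, ?_, deriv_x _ _ _ _, deriv_y _ _ _ _ hy'⟩
  · rw [HHyp_zero, hy]; ring
  · rw [HHyp_zero, hy']; ring
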